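/- Let λ ∈ (0,1], η > 0, p, q ≥ 0, c > b > 0 with b ≤ 1 and c ≥ λ, and (aₙ) strictly increasing to ∞ with a₁ > 0 and 0 < r < √a₁. Then the integral I_{p,q}(λ,η) = ∫_{a₁}^∞ F_{p,q}(λ,b;c;-r²/x) ⌊a⁻¹(x)⌋ / (x^λ(x+r²)^η) dx satisfies I_{p,q}(λ,η) ≤ exp(-(√p+√q)²) · { (1 - 2λb(c+1)/(c(λ+1)(b+1))) · U(λ,η) + 4λb(c+1)² · U(λ-1,η) / (c(λ+1)(b+1)[(λ+1)(b+1)r² + 2(c+1)a₁]) }, where U(λ,η) = ∫_{a₁}^∞ ⌊a⁻¹(x)⌋ / (x^λ(x+r²)^η) dx, assuming the integrals U converge. -/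

import Mathlib

open Real Set MeasureTheory

/-- The (p,q)-extended Gauss hypergeometric function, Euler-type integral representation. -/
noncomputable def pqGauss (a b c z p q : ℝ) : ℝ :=
  (Real.Gamma c / (Real.Gamma b * Real.Gamma (c - b))) *
    ∫ t in (0:ℝ)..1,
      t ^ (b - 1) * (1 - t) ^ (c - b - 1) * (1 - z * t) ^ (-a) *
        Real.exp (-p / t - q / (1 - t))

/-- The auxiliary integral `𝒰(λ, η)`. -/
noncomputable def mathieuU (r lam η : ℝ) (a ainv : ℝ → ℝ) : ℝ :=
  ∫ x in Set.Ioi (a 1), (⌊ainv x⌋ : ℝ) / (x ^ lam * (x + r ^ 2) ^ η)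

/-- The integral `𝓘_{p,q}(λ, η)`. -/
noncomputable def mathieuI (b c p q r lam η : ℝ) (a ainv : ℝ → ℝ) : ℝ :=
  ∫ x in Set.Ioi (a 1),
    pqGauss lam b c (-(r ^ 2) / x) p q * (⌊ainv x⌋ : ℝ) / (x ^ lam * (x + r ^ 2) ^ η)

lemma integrableOn_beta {u v : ℝ} (hu : 0 < u) (hv : 0 < v) :
    IntegrableOn (fun t : ℝ => t ^ (u - 1) * (1 - t) ^ (v - 1)) (Ioo 0 1) := by
  have h := Complex.betaIntegral_convergent (u := (u : ℂ)) (v := (v : ℂ)) (by simpa) (by simpa)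
  rw [intervalIntegrable_iff_integrableOn_Ioo_of_le zero_le_one] at h
  refine IntegrableOn.congr_fun h.re (fun t ht => ?_) measurableSet_Ioo
  have h1 : ((t : ℂ) ^ ((u : ℂ) - 1) * (1 - (t : ℂ)) ^ ((v : ℂ) - 1)) =
      ((t ^ (u - 1) * (1 - t) ^ (v - 1) : ℝ) : ℂ) := by
    rw [Complex.ofReal_mul, Complex.ofReal_cpow ht.1.le,
      Complex.ofReal_cpow (sub_nonneg.2 ht.2.le)]
    push_cast
    rfl
  simp only [h1]
  exact Complex.ofReal_re _

lemma setIntegral_beta {u v : ℝ} (hu : 0 < u) (hv : 0 < v) :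
    ∫ t in Ioo (0 : ℝ) 1, t ^ (u - 1) * (1 - t) ^ (v - 1) =
      Real.Gamma u * Real.Gamma v / Real.Gamma (u + v) := by
  have h := Complex.betaIntegral_eq_Gamma_mul_div (u : ℂ) (v : ℂ) (by simpa) (by simpa)
  rw [Complex.betaIntegral, intervalIntegral.integral_of_le zero_le_one,
    integral_Ioc_eq_integral_Ioo] at h
  have h1 : ∫ t in Ioo (0 : ℝ) 1, (t : ℂ) ^ ((u : ℂ) - 1) * (1 - (t : ℂ)) ^ ((v : ℂ) - 1) =
      ∫ t in Ioo (0 : ℝ) 1, ((t ^ (u - 1) * (1 - t) ^ (v - 1) : ℝ) : ℂ) := by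
    refine setIntegral_congr_fun measurableSet_Ioo fun t ht => ?_
    rw [Complex.ofReal_mul, Complex.ofReal_cpow ht.1.le,
      Complex.ofReal_cpow (sub_nonneg.2 ht.2.le)]
    push_cast
    rfl
  rw [h1, integral_complex_ofReal, ← Complex.ofReal_add, Complex.Gamma_ofReal,
    Complex.Gamma_ofReal, Complex.Gamma_ofReal] at h
  exact_mod_cast h

/-- The diagonal Padé approximant of `(1 + w) ^ a` is a lower bound. -/
lemma pade_le_one_add_rpow {a w : ℝ} (ha0 : 0 < a) (ha1 : a ≤ 1) (hw : 0 ≤ w) :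
    (2 + (1 + a) * w) / (2 + (1 - a) * w) ≤ (1 + w) ^ a := by
  have hd : ∀ x : ℝ, 0 ≤ x → HasDerivAt
      (fun x => a * Real.log (1 + x) - Real.log (2 + (1 + a) * x) + Real.log (2 + (1 - a) * x))
      (a * (1 / (1 + x)) - (1 + a) / (2 + (1 + a) * x) + (1 - a) / (2 + (1 - a) * x)) x := by
    intro x hx
    have h1 : (0 : ℝ) < 1 + x := by linarith
    have h2 : 0 < 2 + (1 + a) * x := by positivity
    have h3 : 0 < 2 + (1 - a) * x := by nlinarith [mul_nonneg (sub_nonneg.2 ha1) hx]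
    have e1 := (((hasDerivAt_id x).const_add 1).log h1.ne').const_mul a
    have e2 := ((((hasDerivAt_id x).const_mul (1 + a)).const_add 2).log h2.ne')
    have e3 := ((((hasDerivAt_id x).const_mul (1 - a)).const_add 2).log h3.ne')
    exact ((e1.sub e2).add e3).congr_deriv (by simp)
  have hmono := monotoneOn_of_deriv_nonneg (convex_Ici (0 : ℝ))
    (fun x hx => (hd x hx).continuousAt.continuousWithinAt)
    (fun x hx => (hd x (interior_subset hx)).differentiableAt.differentiableWithinAt)
    (fun x hx => by
      have hx : (0 : ℝ) ≤ x := interior_subset hx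
      rw [(hd x hx).deriv]
      have h1 : (0 : ℝ) < 1 + x := by linarith
      have h2 : 0 < 2 + (1 + a) * x := by positivity
      have h3 : 0 < 2 + (1 - a) * x := by nlinarith [mul_nonneg (sub_nonneg.2 ha1) hx]
      have h4 : a * (1 / (1 + x)) - (1 + a) / (2 + (1 + a) * x) + (1 - a) / (2 + (1 - a) * x) =
          a * (x ^ 2 * (1 - a ^ 2)) / ((1 + x) * (2 + (1 + a) * x) * (2 + (1 - a) * x)) := by
        rw [mul_one_div, div_sub_div _ _ h1.ne' h2.ne', div_add_div _ _ (by positivity) h3.ne']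
        congr 1
        ring
      rw [h4]
      have h5 : 0 ≤ 1 - a ^ 2 := by nlinarith
      positivity)
  have h := hmono (mem_Ici.2 le_rfl) (mem_Ici.2 hw) hw
  have h1 : (0 : ℝ) < 1 + w := by linarith
  have h2 : 0 < 2 + (1 + a) * w := by positivity
  have h3 : 0 < 2 + (1 - a) * w := by nlinarith [mul_nonneg (sub_nonneg.2 ha1) hw]
  simp only [add_zero, mul_zero, Real.log_one, zero_sub, neg_add_cancel] at h
  rw [← Real.log_le_log_iff (by positivity) (by positivity), Real.log_div h2.ne' h3.ne',
    Real.log_rpow h1]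
  linarith

/-- A quadratic upper bound for `(1 + w) ^ (-a)`, for every value of the parameter `s`. -/
lemma one_add_rpow_neg_le {a w : ℝ} (s : ℝ) (ha0 : 0 < a) (ha1 : a ≤ 1) (hw : 0 ≤ w) :
    (1 + w) ^ (-a) ≤ 1 - 2 * a * w * s + s ^ 2 * (a * w + a * (a + 1) / 2 * w ^ 2) := by
  have h2 : 0 < 2 + (1 + a) * w := by positivity
  have h3 : 0 < 2 + (1 - a) * w := by nlinarith [mul_nonneg (sub_nonneg.2 ha1) hw]
  have h := inv_anti₀ (by positivity) (pade_le_one_add_rpow ha0 ha1 hw)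
  rw [Real.rpow_neg (by linarith)]
  refine h.trans ?_
  rw [inv_div, div_le_iff₀ h2]
  nlinarith [mul_nonneg (mul_nonneg ha0.le hw) (sq_nonneg (s * (2 + (1 + a) * w) - 2))]

lemma sq_sqrt_add_sqrt_le {p q t : ℝ} (hp : 0 ≤ p) (hq : 0 ≤ q) (ht : t ∈ Ioo (0 : ℝ) 1) :
    (√p + √q) ^ 2 ≤ p / t + q / (1 - t) := by
  have h0 := ht.1
  have h1 : 0 < 1 - t := sub_pos.2 ht.2
  rw [div_add_div _ _ h0.ne' h1.ne', le_div_iff₀ (by positivity)]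
  nlinarith [Real.sq_sqrt hp, Real.sq_sqrt hq, sq_nonneg (√p * (1 - t) - √q * t)]

/-- Luke's upper bound, for the `(p,q)`-extended Gauss function. -/
lemma pqGauss_neg_le {a b c z p q : ℝ} (ha0 : 0 < a) (ha1 : a ≤ 1) (hb : 0 < b) (hcb : b < c)
    (hz : 0 ≤ z) (hp : 0 ≤ p) (hq : 0 ≤ q) :
    pqGauss a b c (-z) p q ≤ Real.exp (-(√p + √q) ^ 2) *
      (1 - 2 * a * b * (c + 1) / (c * (a + 1) * (b + 1)) *
        (1 - 2 * (c + 1) / (2 * (c + 1) + (a + 1) * (b + 1) * z))) := by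
  have hc : 0 < c := hb.trans hcb
  have hcb' : 0 < c - b := sub_pos.2 hcb
  have hGb := Real.Gamma_pos_of_pos hb
  have hGc := Real.Gamma_pos_of_pos hc
  have hGcb := Real.Gamma_pos_of_pos hcb'
  set E := Real.exp (-(√p + √q) ^ 2)
  set s : ℝ := 2 * (c + 1) / (2 * (c + 1) + (a + 1) * (b + 1) * z) with hs
  have i0 := integrableOn_beta hb hcb'
  have i1 := integrableOn_beta (u := b + 1) (by linarith) hcb'
  have i2 := integrableOn_beta (u := b + 2) (by linarith) hcb'
  have m0 := setIntegral_beta hb hcb'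
  have m1 := setIntegral_beta (u := b + 1) (by linarith) hcb'
  have m2 := setIntegral_beta (u := b + 2) (by linarith) hcb'
  rw [add_sub_cancel] at m0
  rw [Real.Gamma_add_one hb.ne', show b + 1 + (c - b) = c + 1 by ring,
    Real.Gamma_add_one hc.ne'] at m1
  rw [show b + 2 = b + 1 + 1 by ring, show b + 1 + 1 + (c - b) = c + 1 + 1 by ring,
    Real.Gamma_add_one (by positivity), Real.Gamma_add_one hb.ne',
    Real.Gamma_add_one (by positivity), Real.Gamma_add_one hc.ne',
    show b + 1 + 1 = b + 2 by ring] at m2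
  have i01 : IntegrableOn (fun t : ℝ => t ^ (b - 1) * (1 - t) ^ (c - b - 1) -
      (2 * s - s ^ 2) * a * z * (t ^ (b + 1 - 1) * (1 - t) ^ (c - b - 1))) (Ioo 0 1) :=
    i0.sub (i1.const_mul _)
  have hint : IntegrableOn (fun t : ℝ => E * (t ^ (b - 1) * (1 - t) ^ (c - b - 1) -
      (2 * s - s ^ 2) * a * z * (t ^ (b + 1 - 1) * (1 - t) ^ (c - b - 1)) +
      s ^ 2 * (a * (a + 1) / 2) * z ^ 2 * (t ^ (b + 2 - 1) * (1 - t) ^ (c - b - 1))))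
      (Ioo 0 1) :=
    (i01.add (i2.const_mul _)).const_mul _
  have key : ∫ t in (0:ℝ)..1, t ^ (b - 1) * (1 - t) ^ (c - b - 1) * (1 - (-z) * t) ^ (-a) *
        Real.exp (-p / t - q / (1 - t)) ≤
      ∫ t in Ioo (0 : ℝ) 1, E * (t ^ (b - 1) * (1 - t) ^ (c - b - 1) -
      (2 * s - s ^ 2) * a * z * (t ^ (b + 1 - 1) * (1 - t) ^ (c - b - 1)) +
      s ^ 2 * (a * (a + 1) / 2) * z ^ 2 * (t ^ (b + 2 - 1) * (1 - t) ^ (c - b - 1))) := by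
    rw [intervalIntegral.integral_of_le zero_le_one, integral_Ioc_eq_integral_Ioo]
    refine integral_mono_of_nonneg ?_ hint ?_
    · refine (ae_restrict_iff' measurableSet_Ioo).2 (.of_forall fun t ht => ?_)
      have h0 := ht.1
      have h1 : 0 < 1 - t := sub_pos.2 ht.2
      have h2 : 0 ≤ 1 - (-z) * t := by nlinarith [mul_nonneg hz h0.le]
      simp only [Pi.zero_apply]
      positivity
    · refine (ae_restrict_iff' measurableSet_Ioo).2 (.of_forall fun t ht => ?_)
      have h0 := ht.1
      have h1 : 0 < 1 - t := sub_pos.2 ht.2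
      have hzt := mul_nonneg hz h0.le
      have e1 : Real.exp (-p / t - q / (1 - t)) ≤ E := by
        refine Real.exp_le_exp.2 ?_
        have := sq_sqrt_add_sqrt_le hp hq ht
        rw [neg_div]
        linarith
      have e2 := one_add_rpow_neg_le s ha0 ha1 hzt
      have t1 : t ^ (b + 1 - 1) = t ^ (b - 1) * t := by
        rw [← Real.rpow_add_one h0.ne']
        ring_nf
      have t2 : t ^ (b + 2 - 1) = t ^ (b - 1) * t ^ 2 := by
        rw [← Real.rpow_add_natCast h0.ne']
        congr 1
        push_cast
        ring
      have hw : 0 ≤ t ^ (b - 1) * (1 - t) ^ (c - b - 1) := by positivity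
      have h4 : 0 ≤ (1 + z * t) ^ (-a) := by positivity
      simp only
      rw [t1, t2, neg_mul, sub_neg_eq_add]
      calc _ ≤ t ^ (b - 1) * (1 - t) ^ (c - b - 1) * (1 + z * t) ^ (-a) * E := by gcongr
        _ ≤ t ^ (b - 1) * (1 - t) ^ (c - b - 1) * (1 - 2 * a * (z * t) * s +
              s ^ 2 * (a * (z * t) + a * (a + 1) / 2 * (z * t) ^ 2)) * E := by
            gcongr
        _ = _ := by ring
  rw [integral_const_mul, integral_add i01 (i2.const_mul _),
    integral_sub i0 (i1.const_mul _), integral_const_mul, integral_const_mul, m0, m1, m2] at key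
  have hpre : 0 ≤ Real.Gamma c / (Real.Gamma b * Real.Gamma (c - b)) := by positivity
  refine (mul_le_mul_of_nonneg_left key hpre).trans (le_of_eq ?_)
  have hD : 0 < 2 * (c + 1) + (a + 1) * (b + 1) * z := by positivity
  rw [hs]
  field_simp
  ring

/-- The bound for the integrand, in a form that is uniform in `x ≥ A`. -/
lemma pqGauss_neg_div_le {a b c y x A p q : ℝ} (ha0 : 0 < a) (ha1 : a ≤ 1) (hb : 0 < b)
    (hcb : b < c) (hy : 0 ≤ y) (hA : 0 < A) (hx : A ≤ x) (hp : 0 ≤ p) (hq : 0 ≤ q) :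
    pqGauss a b c (-y / x) p q ≤ Real.exp (-(√p + √q) ^ 2) *
      ((1 - 2 * a * b * (c + 1) / (c * (a + 1) * (b + 1))) +
        4 * a * b * (c + 1) ^ 2 * x /
          (c * (a + 1) * (b + 1) * ((a + 1) * (b + 1) * y + 2 * (c + 1) * A))) := by
  have hc : 0 < c := hb.trans hcb
  have hx0 : 0 < x := hA.trans_le hx
  rw [neg_div]
  refine (pqGauss_neg_le ha0 ha1 hb hcb (div_nonneg hy hx0.le) hp hq).trans ?_
  gcongr
  have h : 2 * (c + 1) / (2 * (c + 1) + (a + 1) * (b + 1) * (y / x)) ≤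
      2 * (c + 1) * x / ((a + 1) * (b + 1) * y + 2 * (c + 1) * A) := by
    have h1 : 2 * (c + 1) / (2 * (c + 1) + (a + 1) * (b + 1) * (y / x)) =
        2 * (c + 1) * x / ((a + 1) * (b + 1) * y + 2 * (c + 1) * x) := by
      have : 0 < (a + 1) * (b + 1) * y + 2 * (c + 1) * x := by positivity
      field_simp
      ring
    rw [h1]
    gcongr
  have hC : 0 ≤ 2 * a * b * (c + 1) / (c * (a + 1) * (b + 1)) := by positivity
  calc _ = 1 - 2 * a * b * (c + 1) / (c * (a + 1) * (b + 1)) +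
        2 * a * b * (c + 1) / (c * (a + 1) * (b + 1)) *
          (2 * (c + 1) / (2 * (c + 1) + (a + 1) * (b + 1) * (y / x))) := by ring
    _ ≤ 1 - 2 * a * b * (c + 1) / (c * (a + 1) * (b + 1)) +
        2 * a * b * (c + 1) / (c * (a + 1) * (b + 1)) *
          (2 * (c + 1) * x / ((a + 1) * (b + 1) * y + 2 * (c + 1) * A)) := by gcongr
    _ = _ := by
      have : 0 < (a + 1) * (b + 1) * y + 2 * (c + 1) * A := by positivity
      field_simp
      ring


theorem mathieuI_bound (lam η r p q b c : ℝ) (a ainv : ℝ → ℝ)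
    (hlam0 : 0 < lam) (hlam1 : lam ≤ 1) (hη : 0 < η)
    (hp : 0 ≤ p) (hq : 0 ≤ q) (hb : 0 < b) (hcb : b < c) (hb1 : b ≤ 1)
    (hclam : lam ≤ c)
    (hpos : ∀ x > (0:ℝ), 0 < a x)
    (hmono : StrictMonoOn a (Set.Ioi 0))
    (hcont : ContinuousOn a (Set.Ioi 0))
    (ha1 : 0 < a 1)
    (htop : Filter.Tendsto a Filter.atTop Filter.atTop)
    (hinv : ∀ x > (0:ℝ), ainv (a x) = x)
    (hinv' : ∀ y ≥ a 1, a (ainv y) = y)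
    (hr0 : 0 < r) (hr1 : r < Real.sqrt (a 1))
    (hU1 : IntegrableOn (fun x => (⌊ainv x⌋ : ℝ) / (x ^ lam * (x + r ^ 2) ^ η))
      (Set.Ioi (a 1)))
    (hU2 : IntegrableOn (fun x => (⌊ainv x⌋ : ℝ) / (x ^ (lam - 1) * (x + r ^ 2) ^ η))
      (Set.Ioi (a 1)))
    (hI : IntegrableOn (fun x =>
      pqGauss lam b c (-(r ^ 2) / x) p q * (⌊ainv x⌋ : ℝ) /
        (x ^ lam * (x + r ^ 2) ^ η)) (Set.Ioi (a 1))) :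
    mathieuI b c p q r lam η a ainv ≤
      Real.exp (-(Real.sqrt p + Real.sqrt q) ^ 2) *
        ((1 - 2 * lam * b * (c + 1) / (c * (lam + 1) * (b + 1))) *
            mathieuU r lam η a ainv +
          4 * lam * b * (c + 1) ^ 2 * mathieuU r (lam - 1) η a ainv /
            (c * (lam + 1) * (b + 1) *
              ((lam + 1) * (b + 1) * r ^ 2 + 2 * (c + 1) * a 1))) := by
  have hfloor : ∀ x ∈ Ioi (a 1), (0 : ℝ) ≤ ⌊ainv x⌋ := by
    intro x hx
    obtain ⟨u, hu, rfl⟩ := intermediate_value_Ici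
      (hcont.mono fun t ht => lt_of_lt_of_le one_pos (mem_Ici.1 ht)) htop (mem_Ici.2 (le_of_lt hx))
    have hu0 : 0 < u := lt_of_lt_of_le one_pos hu
    rw [hinv u hu0]
    exact_mod_cast Int.floor_nonneg.2 hu0.le
  unfold mathieuI mathieuU
  set E := Real.exp (-(√p + √q) ^ 2)
  set C := 1 - 2 * lam * b * (c + 1) / (c * (lam + 1) * (b + 1))
  set D := c * (lam + 1) * (b + 1) * ((lam + 1) * (b + 1) * r ^ 2 + 2 * (c + 1) * a 1)
  set N := 4 * lam * b * (c + 1) ^ 2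
  calc _ ≤ ∫ x in Ioi (a 1), E * (C * ((⌊ainv x⌋ : ℝ) / (x ^ lam * (x + r ^ 2) ^ η)) +
        N / D * ((⌊ainv x⌋ : ℝ) / (x ^ (lam - 1) * (x + r ^ 2) ^ η))) := by
        refine setIntegral_mono_on hI
          (((hU1.const_mul C).add (hU2.const_mul (N / D))).const_mul E) measurableSet_Ioi
          fun x hx => ?_
        have hx0 : 0 < x := ha1.trans hx
        have hf := hfloor x hx
        have hbound := pqGauss_neg_div_le hlam0 hlam1 hb hcb (sq_nonneg r) ha1 (le_of_lt hx) hp hq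
        have hw : 0 ≤ (⌊ainv x⌋ : ℝ) / (x ^ lam * (x + r ^ 2) ^ η) := by positivity
        have hpow : x ^ lam = x ^ (lam - 1) * x := by
          rw [← Real.rpow_add_one hx0.ne', sub_add_cancel]
        rw [mul_div_assoc]
        refine (mul_le_mul_of_nonneg_right hbound hw).trans (le_of_eq ?_)
        have h1 : 0 < x ^ (lam - 1) := by positivity
        have h2 : 0 < (x + r ^ 2) ^ η := by positivity
        have h3 : x * ((⌊ainv x⌋ : ℝ) / (x ^ lam * (x + r ^ 2) ^ η)) =
            (⌊ainv x⌋ : ℝ) / (x ^ (lam - 1) * (x + r ^ 2) ^ η) := by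
          rw [hpow]
          field_simp
        rw [← h3]
        ring
    _ = _ := by
        rw [integral_const_mul, integral_add (hU1.const_mul C) (hU2.const_mul (N / D)),
          integral_const_mul, integral_const_mul]
        ring
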